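/- Let G be an L⁰-convexly compact subset of L⁰(𝓕,B) that has random normal structure, and let 𝒯 be a family of nonexpansive mappings from G to G such that T∘S = S∘T for all T, S ∈ 𝒯. Then 𝒯 has a common fixed point: there exists x ∈ G with T(x) = x for every T ∈ 𝒯. -/

import Mathlib

open MeasureTheory Set Filter Function
open scoped Classical

noncomputable section

namespace RNM


variable {Ω : Type*} [MeasurableSpace Ω] {P : Measure Ω}
variable {B : Type*} [NormedAddCommGroup B] [NormedSpace ℝ B]

/-- The pointwise norm of `x ∈ L⁰(𝓕,B)` as an element of `L⁰(𝓕,ℝ)`. -/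
def nrm (x : Ω →ₘ[P] B) : Ω →ₘ[P] ℝ := x.comp norm continuous_norm

/-- The module action of `L⁰(𝓕,ℝ)` on `L⁰(𝓕,B)` (pointwise scalar multiplication). -/
def msmul (l : Ω →ₘ[P] ℝ) (x : Ω →ₘ[P] B) : Ω →ₘ[P] B :=
  AEEqFun.comp₂ (fun c (b : B) => c • b) continuous_smul l x

/-- `Ĩ_A`, the equivalence class of the indicator function of `A`, in `L⁰(𝓕,ℝ)`. -/
def ind (A : Set Ω) (hA : MeasurableSet A) : Ω →ₘ[P] ℝ :=
  AEEqFun.mk (A.indicator fun _ => (1 : ℝ))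
    ((measurable_const.indicator hA).aestronglyMeasurable)

/-- A subset of `L⁰(𝓕,B)` is a.s. bounded if the norms of its members have a common
bound in `L⁰(𝓕,ℝ)`. -/
def ASBounded (H : Set (Ω →ₘ[P] B)) : Prop :=
  ∃ ξ : Ω →ₘ[P] ℝ, ∀ h ∈ H, nrm h ≤ ξ

/-- The supremum of a subset of `L⁰(𝓕,ℝ)` (junk value `0` if no least upper bound exists;
for nonempty a.s. bounded-above sets the least upper bound always exists, by Dedekind
completeness of `L⁰(𝓕,ℝ)`). -/
def lsup (S : Set (Ω →ₘ[P] ℝ)) : Ω →ₘ[P] ℝ :=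
  if h : ∃ ξ, IsLUB S ξ then h.choose else 0

/-- The infimum of a subset of `L⁰(𝓕,ℝ)` (junk value `0` if no greatest lower bound exists). -/
def linf (S : Set (Ω →ₘ[P] ℝ)) : Ω →ₘ[P] ℝ :=
  if h : ∃ ξ, IsGLB S ξ then h.choose else 0

/-- The random Chebyshev radius `R(H,x)` of `H` at `x`. -/
def Rr (H : Set (Ω →ₘ[P] B)) (x : Ω →ₘ[P] B) : Ω →ₘ[P] ℝ :=
  lsup ((fun y => nrm (x - y)) '' H)

/-- The random Chebyshev radius `R(H,G)` of `H` with respect to `G`. -/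
def RrS (H G : Set (Ω →ₘ[P] B)) : Ω →ₘ[P] ℝ :=
  linf ((fun x => Rr H x) '' G)

/-- The random Chebyshev center `C(H,G)` of `H` with respect to `G`. -/
def Cc (H G : Set (Ω →ₘ[P] B)) : Set (Ω →ₘ[P] B) :=
  {x ∈ G | Rr H x = RrS H G}

/-- The random diameter `D(H)`. -/
def Dd (H : Set (Ω →ₘ[P] B)) : Ω →ₘ[P] ℝ :=
  lsup {ξ | ∃ x ∈ H, ∃ y ∈ H, ξ = nrm (x - y)}

/-- A subset of `L⁰(𝓕,B)` is closed if it is sequentially closed under convergence in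
probability (the `(ε,λ)`-topology). -/
def SeqClosed (S : Set (Ω →ₘ[P] B)) : Prop :=
  ∀ (x : ℕ → Ω →ₘ[P] B) (y : Ω →ₘ[P] B), (∀ n, x n ∈ S) →
    TendstoInMeasure P (fun n => (x n : Ω → B)) atTop y → y ∈ S

/-- The closure of a subset of `L⁰(𝓕,B)` under convergence in probability. -/
def seqClosure (S : Set (Ω →ₘ[P] B)) : Set (Ω →ₘ[P] B) :=
  {y | ∃ x : ℕ → Ω →ₘ[P] B, (∀ n, x n ∈ S) ∧
    TendstoInMeasure P (fun n => (x n : Ω → B)) atTop y}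

/-- `L⁰`-convexity. -/
def LConvex (G : Set (Ω →ₘ[P] B)) : Prop :=
  ∀ x ∈ G, ∀ y ∈ G, ∀ l : Ω →ₘ[P] ℝ, 0 ≤ l → l ≤ 1 →
    msmul l x + msmul (1 - l) y ∈ G

/-- `L⁰`-convex compactness: `G` is a nonempty closed `L⁰`-convex set such that every family
of nonempty closed `L⁰`-convex subsets of `G` with the finite intersection property has
nonempty intersection. -/
def ConvexlyCompact (G : Set (Ω →ₘ[P] B)) : Prop :=
  G.Nonempty ∧ SeqClosed G ∧ LConvex G ∧
    ∀ 𝒞 : Set (Set (Ω →ₘ[P] B)),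
      (∀ C ∈ 𝒞, C.Nonempty ∧ C ⊆ G ∧ SeqClosed C ∧ LConvex C) →
      (∀ S : Finset (Set (Ω →ₘ[P] B)), ↑S ⊆ 𝒞 → (⋂₀ (S : Set (Set (Ω →ₘ[P] B)))).Nonempty) →
      (⋂₀ 𝒞).Nonempty

/-- Random normal structure. -/
def RandNormalStructure (G : Set (Ω →ₘ[P] B)) : Prop :=
  ∀ H ⊆ G, H.Nonempty → ASBounded H → SeqClosed H → LConvex H → Dd H ≠ 0 →
    ∃ z ∈ H, ∀ᵐ ω ∂P, 0 < Dd H ω → Rr H z ω < Dd H ω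

/-- A nonexpansive mapping (on `G`). -/
def NonexpansiveOn (G : Set (Ω →ₘ[P] B)) (T : (Ω →ₘ[P] B) → (Ω →ₘ[P] B)) : Prop :=
  ∀ x ∈ G, ∀ y ∈ G, nrm (T x - T y) ≤ nrm (x - y)

/-- An isometric mapping (on `G`). -/
def IsometricOn (G : Set (Ω →ₘ[P] B)) (T : (Ω →ₘ[P] B) → (Ω →ₘ[P] B)) : Prop :=
  ∀ x ∈ G, ∀ y ∈ G, nrm (T x - T y) = nrm (x - y)

/-- A countable measurable partition of `Ω`. -/
def IsPartition (A : ℕ → Set Ω) : Prop :=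
  (∀ n, MeasurableSet (A n)) ∧ Pairwise (Disjoint on A) ∧ (⋃ n, A n) = univ

/-- `y` is the countable concatenation `Σ_n Ĩ_{A_n} x_n`,
i.e. `y` agrees a.s. with `x n` on `A n` for each `n`. -/
def IsConcat (A : ℕ → Set Ω) (x : ℕ → Ω →ₘ[P] B) (y : Ω →ₘ[P] B) : Prop :=
  ∀ n, ∀ᵐ ω ∂P, ω ∈ A n → y ω = x n ω

/-- `G` is σ-stable: it contains all countable concatenations of its members along
countable measurable partitions of `Ω`. -/
def SigmaStable (G : Set (Ω →ₘ[P] B)) : Prop :=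
  ∀ A : ℕ → Set Ω, IsPartition A → ∀ x : ℕ → Ω →ₘ[P] B, (∀ n, x n ∈ G) →
    ∀ y, IsConcat A x y → y ∈ G

/-- The σ-stable hull of `G`. -/
def sigmaHull (G : Set (Ω →ₘ[P] B)) : Set (Ω →ₘ[P] B) :=
  {y | ∃ A : ℕ → Set Ω, IsPartition A ∧
    ∃ x : ℕ → Ω →ₘ[P] B, (∀ n, x n ∈ G) ∧ IsConcat A x y}

/-- The countable concatenation `Σ_n Ĩ_{A_n} H_n` of a sequence of sets. -/
def concatSet (A : ℕ → Set Ω) (H : ℕ → Set (Ω →ₘ[P] B)) : Set (Ω →ₘ[P] B) :=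
  {y | ∃ x : ℕ → Ω →ₘ[P] B, (∀ n, x n ∈ H n) ∧ IsConcat A x y}

/-- A finitely stable subset of `L⁰(𝓕,B)`. -/
def FinStable (G : Set (Ω →ₘ[P] B)) : Prop :=
  ∀ x ∈ G, ∀ y ∈ G, ∀ A : Set Ω, ∀ hA : MeasurableSet A,
    msmul (ind A hA) x + msmul (ind Aᶜ hA.compl) y ∈ G


section

lemma nrm_coe (x : Ω →ₘ[P] B) : ∀ᵐ ω ∂P, nrm x ω = ‖x ω‖ := AEEqFun.coeFn_comp _ _ _

lemma nrm_sub_coe (x y : Ω →ₘ[P] B) : ∀ᵐ ω ∂P, nrm (x - y) ω = ‖x ω - y ω‖ := by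
  filter_upwards [nrm_coe (x - y), AEEqFun.coeFn_sub x y] with ω h1 h2
  rw [h1, h2]; rfl

lemma nrm_sub_le_iff (x y x' y' : Ω →ₘ[P] B) :
    nrm (x - y) ≤ nrm (x' - y') ↔ ∀ᵐ ω ∂P, ‖x ω - y ω‖ ≤ ‖x' ω - y' ω‖ := by
  rw [← AEEqFun.coeFn_le]
  constructor
  · intro h
    filter_upwards [h, nrm_sub_coe x y, nrm_sub_coe x' y'] with ω h1 h2 h3
    rw [← h2, ← h3]; exact h1
  · intro h
    filter_upwards [h, nrm_sub_coe x y, nrm_sub_coe x' y'] with ω h1 h2 h3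
    rw [h2, h3]; exact h1

lemma comb_coe (l : Ω →ₘ[P] ℝ) (x y : Ω →ₘ[P] B) :
    ∀ᵐ ω ∂P, (msmul l x + msmul (1 - l) y) ω = l ω • x ω + (1 - l ω) • y ω := by
  filter_upwards [AEEqFun.coeFn_add (msmul l x) (msmul (1 - l) y),
    AEEqFun.coeFn_comp₂ (fun c (b : B) => c • b) continuous_smul l x,
    AEEqFun.coeFn_comp₂ (fun c (b : B) => c • b) continuous_smul (1 - l) y,
    AEEqFun.coeFn_sub 1 l, AEEqFun.coeFn_one (α := Ω) (μ := P) (β := ℝ)] with ω h1 h2 h3 h4 h5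
  rw [h1]
  simp only [Pi.add_apply]
  unfold msmul
  rw [h2, h3, h4]
  simp [h5]

lemma zero_one_coe {l : Ω →ₘ[P] ℝ} (h0 : 0 ≤ l) (h1 : l ≤ 1) :
    ∀ᵐ ω ∂P, 0 ≤ l ω ∧ l ω ≤ 1 := by
  rw [← AEEqFun.coeFn_le] at h0 h1
  filter_upwards [h0, h1, AEEqFun.coeFn_one (α := Ω) (μ := P) (β := ℝ),
    AEEqFun.coeFn_zero (α := Ω) (μ := P) (β := ℝ)] with ω a b c d
  rw [c] at b; rw [d] at a
  exact ⟨a, b⟩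

/-- Selections of a field of sets. -/
def sel (P : Measure Ω) (C : Ω → Set B) : Set (Ω →ₘ[P] B) := {y | ∀ᵐ ω ∂P, y ω ∈ C ω}

lemma sel_closed {C : Ω → Set B} (hC : ∀ ω, IsClosed (C ω)) : SeqClosed (sel P C) := by
  intro x y hx hxy
  obtain ⟨ns, -, hns⟩ := hxy.exists_seq_tendsto_ae
  have : ∀ᵐ ω ∂P, ∀ n, x n ω ∈ C ω := ae_all_iff.2 hx
  change ∀ᵐ ω ∂P, y ω ∈ C ω
  filter_upwards [this, hns] with ω h1 h2
  exact (hC ω).mem_of_tendsto h2 (Eventually.of_forall fun n => h1 _)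

lemma sel_convex {C : Ω → Set B} (hC : ∀ ω, Convex ℝ (C ω)) : LConvex (sel P C) := by
  intro x hx y hy l h0 h1
  change ∀ᵐ ω ∂P, _ ∈ C ω
  filter_upwards [hx, hy, comb_coe l x y, zero_one_coe h0 h1] with ω a b c d
  rw [c]
  exact hC ω a b d.1 (by linarith) (by ring)

lemma SeqClosed.inter {S T : Set (Ω →ₘ[P] B)} (hS : SeqClosed S) (hT : SeqClosed T) :
    SeqClosed (S ∩ T) := fun x y hx hxy =>
  ⟨hS x y (fun n => (hx n).1) hxy, hT x y (fun n => (hx n).2) hxy⟩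

lemma LConvex.inter {S T : Set (Ω →ₘ[P] B)} (hS : LConvex S) (hT : LConvex T) :
    LConvex (S ∩ T) := fun x hx y hy l h0 h1 =>
  ⟨hS x hx.1 y hy.1 l h0 h1, hT x hx.2 y hy.2 l h0 h1⟩

lemma SeqClosed.sInter {S : Set (Set (Ω →ₘ[P] B))} (hS : ∀ s ∈ S, SeqClosed s) :
    SeqClosed (⋂₀ S) := fun x y hx hxy s hs => hS s hs x y (fun n => hx n s hs) hxy

lemma LConvex.sInter {S : Set (Set (Ω →ₘ[P] B))} (hS : ∀ s ∈ S, LConvex s) :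
    LConvex (⋂₀ S) := fun x hx y hy l h0 h1 s hs => hS s hs x (hx s hs) y (hy s hs) l h0 h1

lemma LConvex.convex {K : Set (Ω →ₘ[P] B)} (hK : LConvex K) : Convex ℝ K := by
  intro x hx y hy a b ha hb hab
  have := hK x hx y hy (AEEqFun.const Ω a)
    (by
      rw [← AEEqFun.coeFn_le]
      filter_upwards [AEEqFun.coeFn_const (μ := P) Ω a,
        AEEqFun.coeFn_zero (α := Ω) (μ := P) (β := ℝ)] with ω h1 h2
      rw [h1, h2]; exact ha)
    (by
      rw [← AEEqFun.coeFn_le]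
      filter_upwards [AEEqFun.coeFn_const (μ := P) Ω a,
        AEEqFun.coeFn_one (α := Ω) (μ := P) (β := ℝ)] with ω h1 h2
      rw [h1, h2]; simp only [Function.const_apply, Pi.one_apply]; linarith)
  convert this using 1
  apply AEEqFun.ext
  filter_upwards [comb_coe (AEEqFun.const Ω a) x y, AEEqFun.coeFn_const (μ := P) Ω a,
    AEEqFun.coeFn_add (a • x) (b • y), AEEqFun.coeFn_smul a x, AEEqFun.coeFn_smul b y]
    with ω h1 h2 h3 h4 h5
  rw [h1, h2, h3, Pi.add_apply, h4, h5]
  have : b = 1 - a := by linarith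
  simp [this]

lemma real_comb_coe (a b : ℝ) (x y : Ω →ₘ[P] B) :
    ∀ᵐ ω ∂P, (a • x + b • y) ω = a • x ω + b • y ω := by
  filter_upwards [AEEqFun.coeFn_add (a • x) (b • y), AEEqFun.coeFn_smul a x,
    AEEqFun.coeFn_smul b y] with ω h3 h4 h5
  rw [h3, Pi.add_apply, h4, h5]; rfl

/-- gluing of two members. -/
lemma glue_two {K : Set (Ω →ₘ[P] B)} (hK : LConvex K) {x y : Ω →ₘ[P] B} (hx : x ∈ K)
    (hy : y ∈ K) {A : Set Ω} (hA : MeasurableSet A) :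
    ∃ z ∈ K, ∀ᵐ ω ∂P, z ω = if ω ∈ A then x ω else y ω := by
  have hi : ∀ᵐ ω ∂P, (ind A hA : Ω →ₘ[P] ℝ) ω = A.indicator (fun _ => (1 : ℝ)) ω :=
    AEEqFun.coeFn_mk _ _
  refine ⟨_, hK x hx y hy (ind A hA) ?_ ?_, ?_⟩
  · rw [← AEEqFun.coeFn_le]
    filter_upwards [hi, AEEqFun.coeFn_zero (α := Ω) (μ := P) (β := ℝ)] with ω h1 h2
    rw [h1, h2]; exact Set.indicator_nonneg (fun _ _ => zero_le_one) _
  · rw [← AEEqFun.coeFn_le]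
    filter_upwards [hi, AEEqFun.coeFn_one (α := Ω) (μ := P) (β := ℝ)] with ω h1 h2
    rw [h1, h2]; exact Set.indicator_le_self' (fun _ _ => zero_le_one) _
  · filter_upwards [hi, comb_coe (ind A hA) x y] with ω h1 h2
    rw [h2, h1]
    by_cases h : ω ∈ A <;> simp [h]

/-- countable gluing along a measurable index. -/
lemma glue_nat [IsFiniteMeasure P] {K : Set (Ω →ₘ[P] B)} (hc : SeqClosed K) (hK : LConvex K)
    {x : ℕ → Ω →ₘ[P] B} (hx : ∀ n, x n ∈ K) {k : Ω → ℕ} (hk : Measurable k) :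
    ∃ z ∈ K, ∀ᵐ ω ∂P, z ω = x (k ω) ω := by
  have step : ∀ n, ∃ z ∈ K, ∀ᵐ ω ∂P, z ω = if k ω ≤ n then x (k ω) ω else x 0 ω := by
    intro n
    induction n with
    | zero =>
      refine ⟨x 0, hx 0, Eventually.of_forall fun ω => ?_⟩
      split_ifs with h
      · rw [Nat.le_zero.1 h]
      · rfl
    | succ n ih =>
      obtain ⟨z, hz, hz'⟩ := ih
      obtain ⟨w, hw, hw'⟩ := glue_two hK (hx (n + 1)) hz (A := {ω | k ω = n + 1})
        (hk (measurableSet_singleton (n + 1)))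
      refine ⟨w, hw, ?_⟩
      filter_upwards [hz', hw'] with ω h1 h2
      rw [h2, h1]
      by_cases h : k ω = n + 1
      · simp [h]
      · have : k ω ≤ n ↔ k ω ≤ n + 1 := by omega
        simp [h, this]
  choose z hz hz' using step
  have hall := ae_all_iff.2 hz'
  have hlim : ∀ᵐ ω ∂P, Tendsto (fun n => z n ω) atTop (nhds (x (k ω) ω)) := by
    filter_upwards [hall] with ω h
    apply tendsto_const_nhds.congr'
    filter_upwards [eventually_ge_atTop (k ω)] with n hn
    rw [h n, if_pos hn]
  have hm : AEStronglyMeasurable (fun ω => x (k ω) ω) P :=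
    aestronglyMeasurable_of_tendsto_ae atTop (fun n => (z n).aestronglyMeasurable) hlim
  have hmk := AEEqFun.coeFn_mk (fun ω => x (k ω) ω) hm
  refine ⟨AEEqFun.mk _ hm, hc z _ hz ?_, hmk⟩
  apply tendstoInMeasure_of_tendsto_ae (fun n => (z n).aestronglyMeasurable)
  filter_upwards [hlim, hmk] with ω h1 h2
  rw [h2]; exact h1

/-- countable gluing along a countable cover. -/
lemma glue_cover [IsFiniteMeasure P] {K : Set (Ω →ₘ[P] B)} (hc : SeqClosed K) (hK : LConvex K)
    {x : ℕ → Ω →ₘ[P] B} (hx : ∀ n, x n ∈ K) {A : ℕ → Set Ω}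
    (hA : ∀ n, NullMeasurableSet (A n) P) :
    ∃ z ∈ K, ∀ᵐ ω ∂P, (∃ n, ω ∈ A n) → ∃ n, ω ∈ A n ∧ z ω = x n ω := by
  choose A' hsub hm hae using fun n => (hA n).exists_measurable_subset_ae_eq
  let p : Ω → ℕ → Prop := fun ω n => ω ∈ A' n ∨ (∀ m, ω ∉ A' m)
  have hp : ∀ ω, ∃ n, p ω n := by
    intro ω
    by_cases h : ∃ n, ω ∈ A' n
    · obtain ⟨n, hn⟩ := h; exact ⟨n, Or.inl hn⟩
    · push Not at h; exact ⟨0, Or.inr h⟩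
  have hk : Measurable fun ω => Nat.find (hp ω) := by
    apply measurable_find
    intro n
    apply (hm n).union
    have : {ω | ∀ m, ω ∉ A' m} = ⋂ m, (A' m)ᶜ := by ext; simp
    change MeasurableSet {ω | ∀ m, ω ∉ A' m}
    rw [this]
    exact MeasurableSet.iInter fun m => (hm m).compl
  obtain ⟨z, hz, hz'⟩ := glue_nat hc hK hx hk
  refine ⟨z, hz, ?_⟩
  have hall : ∀ᵐ ω ∂P, ∀ n, (ω ∈ A' n) = (ω ∈ A n) := ae_all_iff.2 hae
  filter_upwards [hz', hall] with ω h1 h2 ⟨n, hn⟩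
  refine ⟨Nat.find (hp ω), ?_, h1⟩
  rcases Nat.find_spec (hp ω) with h | h
  · exact hsub _ h
  · exact absurd ((h2 n).symm ▸ hn) (h n)

end

section

lemma ess_seq [IsFiniteMeasure P] {ι : Type*} [Nonempty ι] (f : ι → Ω → ℝ)
    (hf : ∀ i, AEMeasurable (f i) P) :
    ∃ u : ℕ → ι, ∀ i, ∀ᵐ ω ∂P, ∀ ε > 0, ∃ n, f i ω < f (u n) ω + ε := by
  let g : ι → Ω → ENNReal := fun i ω => ENNReal.ofReal (Real.arctan (f i ω) + 2)
  have hg : ∀ i, AEMeasurable (g i) P := fun i =>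
    ((Real.continuous_arctan.measurable.comp_aemeasurable (hf i)).add_const 2).ennreal_ofReal
  have hg4 : ∀ i ω, g i ω ≤ 4 := by
    intro i ω
    have h1 := Real.arctan_lt_pi_div_two (f i ω)
    have h2 := Real.pi_le_four
    have : Real.arctan (f i ω) + 2 ≤ 4 := by linarith
    calc g i ω ≤ ENNReal.ofReal 4 := ENNReal.ofReal_le_ofReal this
      _ = 4 := by norm_num
  let G : (ℕ → ι) → Ω → ENNReal := fun u ω => ⨆ n, g (u n) ω
  have hGm : ∀ u, AEMeasurable (G u) P := fun u => AEMeasurable.iSup fun n => hg (u n)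
  let V : Set ENNReal := range fun u : ℕ → ι => ∫⁻ ω, G u ω ∂P
  have hVne : V.Nonempty := range_nonempty _
  obtain ⟨v, -, hv, hvV⟩ := exists_seq_tendsto_sSup hVne (OrderTop.bddAbove V)
  choose u hu using hvV
  let w : ℕ → ι := fun n => u n.unpair.1 n.unpair.2
  have hw : ∀ k ω, G (u k) ω ≤ G w ω := by
    intro k ω
    refine iSup_le fun n => ?_
    have := le_iSup (fun m => g (w m) ω) (Nat.pair k n)
    simpa [w] using this
  have hV : sSup V ≤ ∫⁻ ω, G w ω ∂P := by
    refine le_of_tendsto' hv fun k => ?_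
    rw [← hu k]
    exact lintegral_mono (hw k)
  have hfin : ∫⁻ ω, G w ω ∂P ≠ ⊤ := by
    have : ∫⁻ ω, G w ω ∂P ≤ ∫⁻ _, 4 ∂P := lintegral_mono fun ω => iSup_le fun n => hg4 _ _
    refine ne_top_of_le_ne_top ?_ this
    rw [lintegral_const]
    exact ENNReal.mul_ne_top (by norm_num) (measure_ne_top _ _)
  refine ⟨w, fun i => ?_⟩
  let w' : ℕ → ι := fun n => Nat.casesOn n i w
  have h1 : ∀ ω, G w ω ≤ G w' ω := fun ω =>
    iSup_le fun n => le_iSup (fun m => g (w' m) ω) (n + 1)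
  have h2 : ∫⁻ ω, G w' ω ∂P ≤ ∫⁻ ω, G w ω ∂P := le_trans (le_sSup (mem_range_self w')) hV
  have h3 := ae_eq_of_ae_le_of_lintegral_le (Eventually.of_forall h1) hfin (hGm w') h2
  filter_upwards [h3] with ω h ε hε
  by_contra hcon
  push Not at hcon
  have h4 : g i ω ≤ G w ω := by
    rw [h]; exact le_iSup (fun m => g (w' m) ω) 0
  have h5 : G w ω ≤ ENNReal.ofReal (Real.arctan (f i ω - ε) + 2) := by
    refine iSup_le fun n => ENNReal.ofReal_le_ofReal ?_
    have : Real.arctan (f (w n) ω) ≤ Real.arctan (f i ω - ε) :=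
      Real.arctan_strictMono.monotone (by linarith [hcon n])
    linarith
  have h6 := h4.trans h5
  have h7 : Real.arctan (f i ω - ε) < Real.arctan (f i ω) := Real.arctan_strictMono (by linarith)
  have h8 := Real.neg_pi_div_two_lt_arctan (f i ω - ε)
  have h9 := Real.pi_le_four
  rw [ENNReal.ofReal_le_ofReal_iff (by linarith)] at h6
  linarith

/-- essential supremum of a bounded family. -/
lemma ess_sup [IsFiniteMeasure P] {ι : Type*} [Nonempty ι] (f : ι → Ω → ℝ)
    (hf : ∀ i, AEMeasurable (f i) P) (ξ : Ω → ℝ) (hξ : ∀ i, ∀ᵐ ω ∂P, f i ω ≤ ξ ω) :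
    ∃ (u : ℕ → ι) (g : Ω → ℝ), AEMeasurable g P ∧ (∀ i, ∀ᵐ ω ∂P, f i ω ≤ g ω) ∧
      (∀ᵐ ω ∂P, ∀ ε > 0, ∃ n, g ω < f (u n) ω + ε) := by
  obtain ⟨u, hu⟩ := ess_seq f hf
  have hb : ∀ᵐ ω ∂P, BddAbove (range fun n => f (u n) ω) := by
    filter_upwards [ae_all_iff.2 fun n => hξ (u n)] with ω h
    exact ⟨ξ ω, by rintro _ ⟨n, rfl⟩; exact h n⟩
  refine ⟨u, fun ω => ⨆ n, f (u n) ω, AEMeasurable.iSup fun n => hf (u n), fun i => ?_, ?_⟩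
  · filter_upwards [hb, hu i] with ω h1 h2
    refine le_of_forall_pos_le_add fun ε hε => ?_
    obtain ⟨n, hn⟩ := h2 ε hε
    have := le_ciSup h1 n
    linarith
  · filter_upwards [hb] with ω h1 ε hε
    obtain ⟨n, hn⟩ := exists_lt_of_lt_ciSup (sub_lt_self (⨆ n, f (u n) ω) hε)
    exact ⟨n, by linarith⟩

/-- essential infimum of a family bounded below. -/
lemma ess_inf [IsFiniteMeasure P] {ι : Type*} [Nonempty ι] (f : ι → Ω → ℝ)
    (hf : ∀ i, AEMeasurable (f i) P) (ξ : Ω → ℝ) (hξ : ∀ i, ∀ᵐ ω ∂P, ξ ω ≤ f i ω) :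
    ∃ (u : ℕ → ι) (g : Ω → ℝ), AEMeasurable g P ∧ (∀ i, ∀ᵐ ω ∂P, g ω ≤ f i ω) ∧
      (∀ᵐ ω ∂P, ∀ ε > 0, ∃ n, f (u n) ω < g ω + ε) := by
  obtain ⟨u, g, hg, h1, h2⟩ := ess_sup (fun i ω => - f i ω) (fun i => (hf i).neg)
    (fun ω => - ξ ω) (fun i => by filter_upwards [hξ i] with ω h; linarith)
  refine ⟨u, fun ω => - g ω, hg.neg, fun i => ?_, ?_⟩
  · filter_upwards [h1 i] with ω h; linarith
  · filter_upwards [h2] with ω h ε hε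
    obtain ⟨n, hn⟩ := h ε hε
    exact ⟨n, by linarith⟩

lemma lsup_isLUB [IsFiniteMeasure P] {S : Set (Ω →ₘ[P] ℝ)} (hS : S.Nonempty) {ξ : Ω →ₘ[P] ℝ}
    (hξ : ∀ s ∈ S, s ≤ ξ) : IsLUB S (lsup S) := by
  have hex : ∃ ξ, IsLUB S ξ := by
    have : Nonempty S := hS.to_subtype
    obtain ⟨u, g, hg, h1, h2⟩ := ess_sup (fun (i : S) ω => (i : Ω →ₘ[P] ℝ) ω)
      (fun i => (i : Ω →ₘ[P] ℝ).aemeasurable) ξ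
      (fun i => AEEqFun.coeFn_le.2 (hξ i i.2))
    have hmk := AEEqFun.coeFn_mk g hg.aestronglyMeasurable
    refine ⟨AEEqFun.mk g hg.aestronglyMeasurable, ?_, ?_⟩
    · intro s hs
      rw [← AEEqFun.coeFn_le]
      filter_upwards [h1 ⟨s, hs⟩, hmk] with ω a b
      rw [b]; exact a
    · intro c hc
      rw [← AEEqFun.coeFn_le]
      have : ∀ᵐ ω ∂P, ∀ n, (u n : Ω →ₘ[P] ℝ) ω ≤ c ω :=
        ae_all_iff.2 fun n => AEEqFun.coeFn_le.2 (hc (u n).2)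
      filter_upwards [h2, hmk, this] with ω a b d
      rw [b]
      refine le_of_forall_pos_le_add fun ε hε => ?_
      obtain ⟨n, hn⟩ := a ε hε
      linarith [d n]
  unfold lsup
  rw [dif_pos hex]
  exact hex.choose_spec

end

section

lemma no_functional {G : Set (Ω →ₘ[P] B)} (hG : ConvexlyCompact G)
    (f : Ω → StrongDual ℝ B) (A : Set Ω) (hA : P A ≠ 0) (x : ℕ → Ω →ₘ[P] B)
    (hx : ∀ n, x n ∈ G) (h : ∀ n : ℕ, ∀ᵐ ω ∂P, ω ∈ A → (n : ℝ) ≤ f ω (x n ω)) : False := by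
  obtain ⟨-, hcl, hcv, hfip⟩ := hG
  let C : ℕ → Set (Ω →ₘ[P] B) := fun n => G ∩ sel P fun ω => {b | ω ∈ A → (n : ℝ) ≤ f ω b}
  have hmem : ∀ n m, n ≤ m → x m ∈ C n := by
    intro n m hnm
    refine ⟨hx m, ?_⟩
    change ∀ᵐ ω ∂P, ω ∈ A → (n : ℝ) ≤ f ω (x m ω)
    filter_upwards [h m] with ω h1 h2
    have : (n : ℝ) ≤ m := by exact_mod_cast hnm
    exact this.trans (h1 h2)
  have key := hfip (range C) ?_ ?_
  · obtain ⟨y, hy⟩ := key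
    have : ∀ᵐ ω ∂P, ∀ n : ℕ, ω ∈ A → (n : ℝ) ≤ f ω (y ω) :=
      ae_all_iff.2 fun n => (hy (C n) (mem_range_self n)).2
    apply hA
    refine measure_mono_null (t := {ω | ¬ ∀ n : ℕ, ω ∈ A → (n : ℝ) ≤ f ω (y ω)}) ?_ this
    intro ω hω hcon
    obtain ⟨n, hn⟩ := exists_nat_gt (f ω (y ω))
    linarith [hcon n hω]
  · rintro _ ⟨n, rfl⟩
    refine ⟨⟨x n, hmem n n le_rfl⟩, inter_subset_left, hcl.inter (sel_closed ?_),
      hcv.inter (sel_convex ?_)⟩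
    · intro ω
      by_cases hω : ω ∈ A
      · simpa [hω] using isClosed_le continuous_const (f ω).continuous
      · simp [hω]
    · intro ω
      by_cases hω : ω ∈ A
      · simpa [hω] using convex_halfSpace_ge (f ω).isBoundedLinearMap.toIsLinearMap (n : ℝ)
      · simpa [hω] using convex_univ
  · intro S hS
    have : ∀ s ∈ S, ∃ n, C n = s := fun s hs => hS hs
    choose! N hN using this
    refine ⟨x (S.sup N), fun s hs => ?_⟩
    rw [← hN s hs]
    exact hmem _ _ (Finset.le_sup hs)

lemma no_functional' [IsFiniteMeasure P] {G : Set (Ω →ₘ[P] B)} (hG : ConvexlyCompact G)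
    (f : Ω → StrongDual ℝ B) (hf : StronglyMeasurable f) (A : Set Ω) (hA : P A ≠ 0)
    (x : ℕ → Ω →ₘ[P] B) (hx : ∀ n, x n ∈ G)
    (h : ∀ ω ∈ A, ∀ m : ℕ, ∃ n, (m : ℝ) ≤ f ω (x n ω)) : False := by
  have step : ∀ m : ℕ, ∃ z ∈ G, ∀ᵐ ω ∂P, ω ∈ A → (m : ℝ) ≤ f ω (z ω) := by
    intro m
    obtain ⟨z, hz, hz'⟩ := glue_cover hG.2.1 hG.2.2.1 hx
      (A := fun n => {ω | (m : ℝ) ≤ f ω (x n ω)}) (fun n => by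
        have h1 : StronglyMeasurable fun ω => f ω (x n ω) :=
          (isBoundedBilinearMap_apply (𝕜 := ℝ) (E := B) (F := ℝ)).continuous.comp_stronglyMeasurable
            (hf.prodMk (x n).stronglyMeasurable)
        exact (measurableSet_le measurable_const h1.measurable).nullMeasurableSet)
    refine ⟨z, hz, ?_⟩
    filter_upwards [hz'] with ω h1 h2
    obtain ⟨n, hn, hn'⟩ := h1 (h ω h2 m)
    rw [hn']; exact hn
  choose z hz hz' using step
  exact no_functional hG f A hA z hz hz'

lemma exists_norming (x : Ω →ₘ[P] B) : ∃ φ : Ω → StrongDual ℝ B, StronglyMeasurable φ ∧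
    (∀ ω, ‖φ ω‖ ≤ 1) ∧ ∀ ω, ‖x ω‖ - 2 ≤ φ ω (x ω) := by
  obtain ⟨c, hc, hcx⟩ := x.stronglyMeasurable.isSeparable_range
  have hc' : (insert (0 : B) c).Countable := hc.insert 0
  obtain ⟨d, hd⟩ := hc'.exists_eq_range (insert_nonempty _ _)
  choose g hg1 hg2 using fun j => exists_dual_vector'' ℝ (d j)
  have hex : ∀ ω, ∃ j, ‖x ω - d j‖ < 1 := by
    intro ω
    have := hcx (mem_range_self ω)
    obtain ⟨b, hb, hb'⟩ := Metric.mem_closure_iff.1 this 1 one_pos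
    have : b ∈ range d := hd ▸ mem_insert_of_mem _ hb
    obtain ⟨j, rfl⟩ := this
    exact ⟨j, by rwa [← dist_eq_norm]⟩
  have hk : Measurable fun ω => Nat.find (hex ω) := by
    apply measurable_find
    intro n
    exact measurableSet_lt
      (x.stronglyMeasurable.sub stronglyMeasurable_const).norm.measurable measurable_const
  refine ⟨fun ω => g (Nat.find (hex ω)), ?_, fun ω => hg1 _, fun ω => ?_⟩
  · exact (continuous_of_discreteTopology (f := g)).comp_stronglyMeasurable hk.stronglyMeasurable
  · have h1 := Nat.find_spec (hex ω)
    set j := Nat.find (hex ω)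
    have h2 : ‖g j (x ω - d j)‖ ≤ ‖x ω - d j‖ := by
      have := (g j).le_opNorm (x ω - d j)
      nlinarith [hg1 j, norm_nonneg (x ω - d j)]
    rw [Real.norm_eq_abs, map_sub] at h2
    have h3 := abs_le.1 h2
    have h4 : ‖x ω‖ ≤ ‖x ω - d j‖ + ‖d j‖ := by
      have := norm_add_le (x ω - d j) (d j)
      simpa using this
    have h5 : g j (d j) = ‖d j‖ := by simpa using hg2 j
    linarith [h3.1]

lemma max_abs_aux (a b : ℝ) (h : ¬ b ≤ |a + b|) : b ≤ |a - b| := by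
  rcases le_or_gt 0 a with ha | ha
  · exact absurd (by rw [le_abs]; left; linarith) h
  · rw [le_abs]; right; linarith

lemma gliding (x : ℕ → Ω →ₘ[P] B) : ∃ f : Ω → StrongDual ℝ B, StronglyMeasurable f ∧
    ∀ n ω, (1 / 3 : ℝ) ^ n * (‖x n ω‖ / 2 - 2) ≤ |f ω (x n ω)| := by
  choose φ hφm hφ1 hφ2 using fun n => exists_norming (x n)
  let st : ℕ → (Ω → StrongDual ℝ B) → Ω → StrongDual ℝ B := fun n F ω =>
    if (1 / 3 : ℝ) ^ n * φ n ω (x n ω) ≤ |F ω (x n ω) + (1 / 3 : ℝ) ^ n * φ n ω (x n ω)|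
    then F ω + (1 / 3 : ℝ) ^ n • φ n ω else F ω - (1 / 3 : ℝ) ^ n • φ n ω
  let F : ℕ → Ω → StrongDual ℝ B := fun n => Nat.rec (fun _ => 0) (fun n F => st n F) n
  have hF : ∀ n, F (n + 1) = st n (F n) := fun n => rfl
  have hap : ∀ n (g : Ω → StrongDual ℝ B), StronglyMeasurable g →
      Measurable fun ω => g ω (x n ω) := fun n g hg =>
    ((isBoundedBilinearMap_apply (𝕜 := ℝ) (E := B) (F := ℝ)).continuous.comp_stronglyMeasurable
      (hg.prodMk (x n).stronglyMeasurable)).measurable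
  have hFm : ∀ n, StronglyMeasurable (F n) := by
    intro n
    induction n with
    | zero => exact stronglyMeasurable_const
    | succ n ih =>
      rw [hF]
      have h0 : StronglyMeasurable fun ω => (1 / 3 : ℝ) ^ n • φ n ω :=
        (continuous_const_smul ((1 / 3 : ℝ) ^ n)).comp_stronglyMeasurable (hφm n)
      refine StronglyMeasurable.ite ?_ (ih.add h0) (ih.sub h0)
      have h1 := (hap n (φ n) (hφm n)).const_mul ((1 / 3 : ℝ) ^ n)
      have h2 := hap n (F n) ih
      exact measurableSet_le h1 (continuous_abs.measurable.comp (h2.add h1))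
  have hpos : ∀ n : ℕ, (0 : ℝ) < (1 / 3) ^ n := fun n => by positivity
  have hdist : ∀ ω n, dist (F n ω) (F (n + 1) ω) ≤ 1 * (1 / 3 : ℝ) ^ n := by
    intro ω n
    have h1 : ‖(1 / 3 : ℝ) ^ n • φ n ω‖ ≤ 1 * (1 / 3 : ℝ) ^ n := by
      rw [norm_smul, Real.norm_eq_abs, abs_of_pos (hpos n)]
      nlinarith [hφ1 n ω, hpos n]
    rw [hF]
    simp only [st]
    split_ifs
    · rw [dist_eq_norm]; simpa using h1
    · rw [dist_eq_norm]; simpa using h1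
  have hlow : ∀ ω n, (1 / 3 : ℝ) ^ n * (‖x n ω‖ - 2) ≤ |F (n + 1) ω (x n ω)| := by
    intro ω n
    have h0 : (1 / 3 : ℝ) ^ n * (‖x n ω‖ - 2) ≤ (1 / 3 : ℝ) ^ n * φ n ω (x n ω) :=
      mul_le_mul_of_nonneg_left (hφ2 n ω) (hpos n).le
    refine h0.trans ?_
    rw [hF]
    simp only [st]
    split_ifs with h
    · simpa using h
    · simpa using max_abs_aux _ _ h
  have hlim : ∀ ω, ∃ a, Tendsto (fun n => F n ω) atTop (nhds a) := fun ω =>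
    cauchySeq_tendsto_of_complete
      (cauchySeq_of_le_geometric (1 / 3) 1 (by norm_num) (hdist ω))
  choose f hf using hlim
  refine ⟨f, stronglyMeasurable_of_tendsto atTop hFm (tendsto_pi_nhds.2 hf), fun n ω => ?_⟩
  have h1 := dist_le_of_le_geometric_of_tendsto (1 / 3) 1 (by norm_num) (hdist ω) (hf ω) (n + 1)
  have h2 : ‖(F (n + 1) ω - f ω) (x n ω)‖ ≤ (1 / 3 : ℝ) ^ n / 2 * ‖x n ω‖ := by
    refine ((F (n + 1) ω - f ω).le_opNorm _).trans ?_
    refine mul_le_mul_of_nonneg_right ?_ (norm_nonneg _)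
    rw [← dist_eq_norm]
    refine h1.trans (le_of_eq ?_)
    rw [pow_succ]; ring
  have h3 := hlow ω n
  have h4 : |F (n + 1) ω (x n ω)| ≤ |f ω (x n ω)| + ‖(F (n + 1) ω - f ω) (x n ω)‖ := by
    have := abs_add_le (f ω (x n ω)) ((F (n + 1) ω - f ω) (x n ω))
    simpa using this
  linarith

lemma bounded_of_compact [IsFiniteMeasure P] {G : Set (Ω →ₘ[P] B)} (hG : ConvexlyCompact G) :
    ∃ ξ : Ω → ℝ, AEMeasurable ξ P ∧ ∀ x ∈ G, ∀ᵐ ω ∂P, ‖x ω‖ ≤ ξ ω := by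
  have : Nonempty G := hG.1.to_subtype
  obtain ⟨u, hu⟩ := ess_seq (P := P) (fun (x : G) ω => ‖(x : Ω →ₘ[P] B) ω‖)
    (fun x => (x : Ω →ₘ[P] B).stronglyMeasurable.norm.measurable.aemeasurable)
  let A : Set Ω := {ω | ¬ BddAbove (range fun n => ‖(u n : Ω →ₘ[P] B) ω‖)}
  by_cases hA : P A = 0
  · refine ⟨fun ω => ⨆ n, ‖(u n : Ω →ₘ[P] B) ω‖, AEMeasurable.iSup fun n =>
      (u n : Ω →ₘ[P] B).stronglyMeasurable.norm.measurable.aemeasurable, fun x hx => ?_⟩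
    have hA' : ∀ᵐ ω ∂P, BddAbove (range fun n => ‖(u n : Ω →ₘ[P] B) ω‖) := hA
    filter_upwards [hA', hu ⟨x, hx⟩] with ω h1 h2
    refine le_of_forall_pos_le_add fun ε hε => ?_
    obtain ⟨n, hn⟩ := h2 ε hε
    have := le_ciSup h1 n
    linarith
  · exfalso
    have step : ∀ n : ℕ, ∃ z ∈ G, ∀ᵐ ω ∂P, ω ∈ A → 4 + 2 * n * 3 ^ n ≤ ‖z ω‖ := by
      intro n
      obtain ⟨z, hz, hz'⟩ := glue_cover hG.2.1 hG.2.2.1 (fun j => (u j).2)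
        (A := fun j => {ω | (4 + 2 * n * 3 ^ n : ℝ) ≤ ‖(u j : Ω →ₘ[P] B) ω‖}) (fun j =>
          (measurableSet_le measurable_const
            (u j : Ω →ₘ[P] B).stronglyMeasurable.norm.measurable).nullMeasurableSet)
      refine ⟨z, hz, ?_⟩
      filter_upwards [hz'] with ω h1 h2
      have : ∃ j, (4 + 2 * n * 3 ^ n : ℝ) ≤ ‖(u j : Ω →ₘ[P] B) ω‖ := by
        by_contra hcon
        push Not at hcon
        exact h2 ⟨_, by rintro _ ⟨j, rfl⟩; exact (hcon j).le⟩
      obtain ⟨j, hj, hj'⟩ := h1 this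
      rw [hj']; exact hj
    choose x hx hx' using step
    obtain ⟨f, hfm, hf⟩ := gliding x
    have hbig : ∀ᵐ ω ∂P, ∀ n : ℕ, ω ∈ A → (n : ℝ) ≤ |f ω (x n ω)| := by
      filter_upwards [ae_all_iff.2 hx'] with ω h n hω
      refine le_trans ?_ (hf n ω)
      have h1 := h n hω
      have h2 : (1 / 3 : ℝ) ^ n * (n * 3 ^ n) = n := by
        rw [mul_left_comm, ← mul_pow]; norm_num
      calc (n : ℝ) = (1 / 3 : ℝ) ^ n * (n * 3 ^ n) := h2.symm
        _ ≤ _ := mul_le_mul_of_nonneg_left (by linarith) (by positivity)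
    let A1 : Set Ω := {ω | ∀ m : ℕ, ∃ n, (m : ℝ) ≤ f ω (x n ω)}
    let A2 : Set Ω := {ω | ∀ m : ℕ, ∃ n, (m : ℝ) ≤ (-f ω) (x n ω)}
    have h1 : P A1 = 0 := by
      by_contra h
      exact no_functional' hG f hfm A1 h x hx (fun ω hω => hω)
    have h2 : P A2 = 0 := by
      by_contra h
      exact no_functional' hG (fun ω => -f ω) hfm.neg A2 h x hx (fun ω hω => hω)
    apply hA
    have h1' : ∀ᵐ ω ∂P, ω ∉ A1 := by rw [ae_iff]; simpa using h1
    have h2' : ∀ᵐ ω ∂P, ω ∉ A2 := by rw [ae_iff]; simpa using h2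
    have : ∀ᵐ ω ∂P, ω ∉ A := by
      filter_upwards [h1', h2', hbig] with ω a1 a2 a3 hω
      simp only [A1, A2, mem_ofPred_eq, not_forall, not_exists, not_le] at a1 a2
      obtain ⟨m1, hm1⟩ := a1
      obtain ⟨m2, hm2⟩ := a2
      have h := a3 (m1 + m2) hω
      have h3 := hm1 (m1 + m2)
      have h4 := hm2 (m1 + m2)
      simp only [neg_apply] at h4
      push_cast at h
      have hp1 : (0 : ℝ) ≤ m1 := Nat.cast_nonneg _
      have hp2 : (0 : ℝ) ≤ m2 := Nat.cast_nonneg _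
      rcases le_abs.1 h with h | h <;> linarith
    rw [ae_iff] at this
    simpa using this

end

section

lemma chain_finset {α : Type*} {c : Set (Set α)} (hc : IsChain (· ⊆ ·) c) (hne : c.Nonempty)
    (S : Finset (Set α)) (hS : (S : Set (Set α)) ⊆ c) : ∃ m ∈ c, ∀ s ∈ S, m ⊆ s := by
  induction S using Finset.induction_on with
  | empty => obtain ⟨m, hm⟩ := hne; exact ⟨m, hm, by simp⟩
  | insert a S _ ih =>
    obtain ⟨m, hm, hmS⟩ := ih (fun s hs => hS (by simp at hs ⊢; exact Or.inr hs))
    have ha : a ∈ c := hS (by simp)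
    rcases hc.total ha hm with h | h
    · refine ⟨a, ha, fun s hs => ?_⟩
      rcases Finset.mem_insert.1 hs with rfl | hs
      · exact subset_rfl
      · exact h.trans (hmS s hs)
    · refine ⟨m, hm, fun s hs => ?_⟩
      rcases Finset.mem_insert.1 hs with rfl | hs
      · exact h
      · exact hmS s hs

/-- admissible invariant sets -/
def Adm (𝒯 : Set ((Ω →ₘ[P] B) → (Ω →ₘ[P] B))) (K : Set (Ω →ₘ[P] B)) : Prop :=
  K.Nonempty ∧ SeqClosed K ∧ LConvex K ∧ ∀ T ∈ 𝒯, MapsTo T K K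

lemma exists_minimal_adm {G : Set (Ω →ₘ[P] B)} (hG : ConvexlyCompact G)
    (𝒯 : Set ((Ω →ₘ[P] B) → (Ω →ₘ[P] B))) (hmaps : ∀ T ∈ 𝒯, MapsTo T G G) :
    ∃ K ⊆ G, Adm 𝒯 K ∧ ∀ K' ⊆ K, Adm 𝒯 K' → K ⊆ K' := by
  obtain ⟨hne, hcl, hcv, hfip⟩ := hG
  obtain ⟨K, hKG, hK⟩ := zorn_superset_nonempty {K | K ⊆ G ∧ Adm 𝒯 K} (by
    intro c hc hchain hcne
    refine ⟨⋂₀ c, ⟨?_, ?_, SeqClosed.sInter fun s hs => (hc hs).2.2.1,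
      LConvex.sInter fun s hs => (hc hs).2.2.2.1, ?_⟩, fun s hs => sInter_subset_of_mem hs⟩
    · obtain ⟨s, hs⟩ := hcne
      exact (sInter_subset_of_mem hs).trans (hc hs).1
    · apply hfip
      · intro C hC
        exact ⟨(hc hC).2.1, (hc hC).1, (hc hC).2.2.1, (hc hC).2.2.2.1⟩
      · intro S hS
        obtain ⟨m, hm, hmS⟩ := chain_finset hchain hcne S hS
        obtain ⟨x, hx⟩ := (hc hm).2.1
        exact ⟨x, fun s hs => hmS s hs hx⟩
    · intro T hT x hx s hs
      exact (hc hs).2.2.2.2 T hT (hx s hs)) G ⟨subset_rfl, hne, hcl, hcv, hmaps⟩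
  refine ⟨K, hKG, hK.prop.2, fun K' hK' hadm => ?_⟩
  exact hK.le_of_le ⟨hK'.trans hKG, hadm⟩ hK'

/-- `c` is an eventual bound of the distance of the orbit to the points of `F`. -/
def Ub (S : Set ((Ω →ₘ[P] B) → (Ω →ₘ[P] B))) (x0 : Ω →ₘ[P] B) (F : Set (Ω →ₘ[P] B))
    (c : Ω → ℝ) : Prop :=
  AEMeasurable c P ∧ ∃ s ∈ S, ∀ t ∈ S, ∀ y ∈ F, ∀ᵐ ω ∂P, ‖y ω - t (s x0) ω‖ ≤ c ω

/-- `ρ` dominates the infimum of the eventual bounds. -/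
def AsB (S : Set ((Ω →ₘ[P] B) → (Ω →ₘ[P] B))) (x0 : Ω →ₘ[P] B) (F : Set (Ω →ₘ[P] B))
    (ρ : Ω → ℝ) : Prop :=
  ∃ c : ℕ → Ω → ℝ, (∀ k, Ub S x0 F (c k)) ∧ ∀ᵐ ω ∂P, ∀ ε > 0, ∃ k, c k ω < ρ ω + ε

/-- A commutative semigroup of self maps of `K`. -/
structure Sgp (S : Set ((Ω →ₘ[P] B) → (Ω →ₘ[P] B))) (K : Set (Ω →ₘ[P] B)) : Prop where
  id_mem : id ∈ S
  mul_mem : ∀ s ∈ S, ∀ t ∈ S, s ∘ t ∈ S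
  maps : ∀ s ∈ S, MapsTo s K K
  comm : ∀ s ∈ S, ∀ t ∈ S, ∀ x ∈ K, s (t x) = t (s x)

variable {S : Set ((Ω →ₘ[P] B) → (Ω →ₘ[P] B))} {K : Set (Ω →ₘ[P] B)} {x0 : Ω →ₘ[P] B}

lemma Ub.union (hS : Sgp S K) (hx0 : x0 ∈ K) {F F' : Set (Ω →ₘ[P] B)} {c c' : Ω → ℝ}
    (h : Ub S x0 F c) (h' : Ub S x0 F' c') : ∃ s ∈ S, ∀ t ∈ S,
      (∀ y ∈ F, ∀ᵐ ω ∂P, ‖y ω - t (s x0) ω‖ ≤ c ω) ∧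
      (∀ y ∈ F', ∀ᵐ ω ∂P, ‖y ω - t (s x0) ω‖ ≤ c' ω) := by
  obtain ⟨-, s, hs, h⟩ := h
  obtain ⟨-, s', hs', h'⟩ := h'
  refine ⟨s ∘ s', hS.mul_mem s hs s' hs', fun t ht => ⟨fun y hy => ?_, fun y hy => ?_⟩⟩
  · have := h (t ∘ s') (hS.mul_mem _ ht _ hs') y hy
    simp only [comp_apply] at this ⊢
    rwa [hS.comm s hs s' hs' x0 hx0]
  · exact h' (t ∘ s) (hS.mul_mem _ ht _ hs) y hy

lemma AsB.union (hS : Sgp S K) (hx0 : x0 ∈ K) {F F' : Set (Ω →ₘ[P] B)} {ρ : Ω → ℝ}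
    (h : AsB S x0 F ρ) (h' : AsB S x0 F' ρ) : AsB S x0 (F ∪ F') ρ := by
  obtain ⟨c, hc, hρ⟩ := h
  obtain ⟨c', hc', hρ'⟩ := h'
  refine ⟨fun k ω => max (c k.unpair.1 ω) (c' k.unpair.2 ω), fun k => ?_, ?_⟩
  · obtain ⟨s, hs, h⟩ := (hc k.unpair.1).union hS hx0 (hc' k.unpair.2)
    refine ⟨(hc _).1.max (hc' _).1, s, hs, fun t ht y hy => ?_⟩
    rcases hy with hy | hy
    · filter_upwards [(h t ht).1 y hy] with ω hω using hω.trans (le_max_left _ _)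
    · filter_upwards [(h t ht).2 y hy] with ω hω using hω.trans (le_max_right _ _)
  · filter_upwards [hρ, hρ'] with ω h1 h2 ε hε
    obtain ⟨k, hk⟩ := h1 ε hε
    obtain ⟨m, hm⟩ := h2 ε hε
    exact ⟨Nat.pair k m, by simpa using ⟨hk, hm⟩⟩

lemma AsB.convex (hS : Sgp S K) (hx0 : x0 ∈ K) (ρ : Ω → ℝ) :
    LConvex {y : Ω →ₘ[P] B | AsB S x0 {y} ρ} := by
  rintro x ⟨c, hc, hρ⟩ y ⟨c', hc', hρ'⟩ l h0 h1
  have hl := zero_one_coe h0 h1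
  refine ⟨fun k ω => l ω * c k.unpair.1 ω + (1 - l ω) * c' k.unpair.2 ω, fun k => ?_, ?_⟩
  · obtain ⟨s, hs, h⟩ := (hc k.unpair.1).union hS hx0 (hc' k.unpair.2)
    refine ⟨(l.aemeasurable.mul (hc _).1).add
      ((l.aemeasurable.const_sub 1).mul (hc' _).1), s, hs, fun t ht z hz => ?_⟩
    rw [mem_singleton_iff] at hz
    subst hz
    filter_upwards [(h t ht).1 x rfl, (h t ht).2 y rfl, comb_coe l x y, hl] with ω a b d e
    rw [d]
    set w := t (s x0) ω
    have : l ω • x ω + (1 - l ω) • y ω - w = l ω • (x ω - w) + (1 - l ω) • (y ω - w) := by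
      module
    rw [this]
    refine (norm_add_le _ _).trans ?_
    rw [norm_smul, norm_smul, Real.norm_eq_abs, Real.norm_eq_abs, abs_of_nonneg e.1,
      abs_of_nonneg (by linarith [e.2])]
    exact add_le_add (mul_le_mul_of_nonneg_left a e.1)
      (mul_le_mul_of_nonneg_left b (by linarith [e.2]))
  · filter_upwards [hρ, hρ', hl] with ω h1 h2 h3 ε hε
    obtain ⟨k, hk⟩ := h1 (ε / 2) (by linarith)
    obtain ⟨m, hm⟩ := h2 (ε / 2) (by linarith)
    refine ⟨Nat.pair k m, ?_⟩
    simp only [Nat.unpair_pair]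
    nlinarith [h3.1, h3.2]

lemma AsB.closed (ρ : Ω → ℝ) : SeqClosed {y : Ω →ₘ[P] B | AsB S x0 {y} ρ} := by
  intro x y hx hxy
  obtain ⟨ns, -, hns⟩ := hxy.exists_seq_tendsto_ae
  choose c hc hρ using hx
  refine ⟨fun k ω => c (ns k.unpair.1) k.unpair.2 ω + ‖y ω - x (ns k.unpair.1) ω‖,
    fun k => ?_, ?_⟩
  · obtain ⟨hm, s, hs, h⟩ := hc (ns k.unpair.1) k.unpair.2
    refine ⟨hm.add (y.stronglyMeasurable.sub
      (x (ns k.unpair.1)).stronglyMeasurable).norm.measurable.aemeasurable, s, hs,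
      fun t ht z hz => ?_⟩
    rw [mem_singleton_iff] at hz
    subst hz
    filter_upwards [h t ht _ rfl] with ω hω
    have := norm_sub_le_norm_sub_add_norm_sub (z ω) (x (ns k.unpair.1) ω) (t (s x0) ω)
    linarith
  · filter_upwards [hns, ae_all_iff.2 hρ] with ω h1 h2 ε hε
    obtain ⟨j, hj⟩ := (Metric.tendsto_atTop.1 h1 (ε / 2) (by linarith))
    have hj := hj j le_rfl
    rw [dist_comm, dist_eq_norm] at hj
    obtain ⟨k, hk⟩ := h2 (ns j) (ε / 2) (by linarith)
    refine ⟨Nat.pair j k, ?_⟩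
    simp only [Nat.unpair_pair]
    linarith

lemma AsB.map (hS : Sgp S K) (hx0 : x0 ∈ K) {T : (Ω →ₘ[P] B) → (Ω →ₘ[P] B)} (hT : T ∈ S)
    (hne : NonexpansiveOn K T) {y : Ω →ₘ[P] B} (hy : y ∈ K) {ρ : Ω → ℝ}
    (h : AsB S x0 {y} ρ) : AsB S x0 {T y} ρ := by
  obtain ⟨c, hc, hρ⟩ := h
  refine ⟨c, fun k => ?_, hρ⟩
  obtain ⟨hm, s, hs, h⟩ := hc k
  refine ⟨hm, T ∘ s, hS.mul_mem _ hT _ hs, fun t ht z hz => ?_⟩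
  rw [mem_singleton_iff] at hz
  subst hz
  have hsx := hS.maps s hs hx0
  have h1 := (nrm_sub_le_iff _ _ _ _).1 (hne y hy (t (s x0)) (hS.maps t ht hsx))
  filter_upwards [h t ht y rfl, h1] with ω a b
  simp only [comp_apply]
  rw [hS.comm t ht T hT _ hsx]
  exact b.trans a

lemma exists_const_radius [IsFiniteMeasure P] {𝒯 : Set ((Ω →ₘ[P] B) → (Ω →ₘ[P] B))}
    (hS : Sgp S K) (hTS : 𝒯 ⊆ S) (hne : ∀ T ∈ 𝒯, NonexpansiveOn K T) (hadm : Adm 𝒯 K)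
    (hmin : ∀ K' ⊆ K, Adm 𝒯 K' → K ⊆ K') (hx0 : x0 ∈ K) {ξ : Ω → ℝ} (hξm : AEMeasurable ξ P)
    (hξ : ∀ x ∈ K, ∀ᵐ ω ∂P, ‖x ω‖ ≤ ξ ω) :
    ∃ ρ : Ω → ℝ, AEMeasurable ρ P ∧ (∀ᵐ ω ∂P, 0 ≤ ρ ω) ∧
      (∀ y ∈ K, AsB S x0 {y} ρ) ∧ (∀ y ∈ K, ∀ c, Ub S x0 {y} c → ∀ᵐ ω ∂P, ρ ω ≤ c ω) := by
  have hprop : ∀ ρ, ∀ y ∈ K, AsB S x0 {y} ρ → ∀ z ∈ K, AsB S x0 {z} ρ := by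
    intro ρ y hy h z hz
    have := hmin (K ∩ {y | AsB S x0 {y} ρ}) inter_subset_left
      ⟨⟨y, hy, h⟩, hadm.2.1.inter (AsB.closed ρ), hadm.2.2.1.inter (AsB.convex hS hx0 ρ),
        fun T hT z hz => ⟨hadm.2.2.2 T hT hz.1, hz.2.map hS hx0 (hTS hT) (hne T hT) hz.1⟩⟩
    exact (this hz).2
  have hub : Ub S x0 {x0} (fun ω => 2 * ξ ω) := by
    refine ⟨hξm.const_mul 2, id, hS.id_mem, fun t ht y hy => ?_⟩
    rw [mem_singleton_iff] at hy
    subst hy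
    filter_upwards [hξ y hx0, hξ _ (hS.maps t ht hx0)] with ω a b
    have := norm_sub_le (y ω) (t y ω)
    simp only [id_eq]
    linarith
  have : Nonempty {c // Ub S x0 {x0} c} := ⟨⟨_, hub⟩⟩
  have hpos : ∀ c, Ub S x0 {x0} c → ∀ᵐ ω ∂P, 0 ≤ c ω := by
    rintro c ⟨-, s, hs, h⟩
    filter_upwards [h id hS.id_mem x0 rfl] with ω hω using (norm_nonneg _).trans hω
  obtain ⟨u, ρ, hρm, h1, h2⟩ := ess_inf (P := P) (fun (c : {c // Ub S x0 {x0} c}) ω => c.1 ω)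
    (fun c => c.2.1) (fun _ => 0) (fun c => hpos c.1 c.2)
  refine ⟨ρ, hρm, ?_, hprop ρ x0 hx0 ⟨fun n => (u n).1, fun n => (u n).2, h2⟩, ?_⟩
  · filter_upwards [h2, ae_all_iff.2 fun n => hpos _ (u n).2] with ω a b
    refine le_of_forall_pos_le_add fun ε hε => ?_
    obtain ⟨n, hn⟩ := a ε hε
    linarith [b n]
  · intro y hy c hc
    have hA : AsB S x0 {y} c := ⟨fun _ => c, fun _ => hc,
      Eventually.of_forall fun ω ε hε => ⟨0, by linarith⟩⟩
    obtain ⟨d, hd, hdc⟩ := hprop c y hy hA x0 hx0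
    filter_upwards [hdc, ae_all_iff.2 fun n => h1 ⟨d n, hd n⟩] with ω a b
    refine le_of_forall_pos_le_add fun ε hε => ?_
    obtain ⟨n, hn⟩ := a ε hε
    linarith [b n]

lemma AsB.finite (hS : Sgp S K) (hx0 : x0 ∈ K) {ρ : Ω → ℝ} (hρ : ∀ y ∈ K, AsB S x0 {y} ρ)
    {F : Set (Ω →ₘ[P] B)} (hF : F.Finite) (hFK : F ⊆ K) : AsB S x0 F ρ := by
  induction F, hF using Set.Finite.induction_on with
  | empty =>
    obtain ⟨c, hc, h⟩ := hρ x0 hx0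
    refine ⟨c, fun k => ⟨(hc k).1, id, hS.id_mem, fun t ht y hy => absurd hy (by simp)⟩, h⟩
  | insert _ _ ih =>
    rw [insert_eq]
    exact (hρ _ (hFK (mem_insert _ _))).union hS hx0 (ih ((subset_insert _ _).trans hFK))

lemma pick [IsFiniteMeasure P] (hS : Sgp S K) (hcl : SeqClosed K) (hcv : LConvex K)
    (hx0 : x0 ∈ K) {ρ : Ω → ℝ} (hρm : AEMeasurable ρ P) (hρ : ∀ y ∈ K, AsB S x0 {y} ρ)
    (hρ' : ∀ y ∈ K, ∀ c, Ub S x0 {y} c → ∀ᵐ ω ∂P, ρ ω ≤ c ω) {ξ : Ω → ℝ}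
    (hξ : ∀ x ∈ K, ∀ᵐ ω ∂P, ‖x ω‖ ≤ ξ ω)
    {F : Set (Ω →ₘ[P] B)} (hF : F.Finite) (hFK : F ⊆ K) {a : Ω →ₘ[P] B} (ha : a ∈ K)
    {ε : Ω → ℝ} (hε : AEMeasurable ε P) :
    ∃ w ∈ K, ∀ᵐ ω ∂P, 0 < ε ω →
      (∀ y ∈ F, ‖y ω - w ω‖ ≤ ρ ω + ε ω) ∧ ρ ω - ε ω ≤ ‖a ω - w ω‖ := by
  obtain ⟨c, hc, hcρ⟩ := AsB.finite hS hx0 hρ hF hFK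
  choose hcm s hs hcs using hc
  have : Nonempty S := ⟨⟨id, hS.id_mem⟩⟩
  have step : ∀ k, ∃ t : ℕ → S, ∀ᵐ ω ∂P, ∀ e > 0, ∃ n,
      ρ ω < ‖a ω - (t n).1 (s k x0) ω‖ + e := by
    intro k
    obtain ⟨t, g, hgm, h1, h2⟩ := ess_sup (P := P)
      (fun (t : S) ω => ‖a ω - t.1 (s k x0) ω‖)
      (fun t => (a.stronglyMeasurable.sub (t.1 (s k x0)).stronglyMeasurable).norm.measurable.aemeasurable)
      (fun ω => 2 * ξ ω) (fun t => by
        filter_upwards [hξ a ha, hξ _ (hS.maps t.1 t.2 (hS.maps _ (hs k) hx0))] with ω p q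
        linarith [norm_sub_le (a ω) (t.1 (s k x0) ω)])
    have h3 := hρ' a ha g ⟨hgm, s k, hs k, fun t ht y hy => by
      rw [mem_singleton_iff] at hy; subst hy; exact h1 ⟨t, ht⟩⟩
    refine ⟨t, ?_⟩
    filter_upwards [h2, h3] with ω p q e he
    obtain ⟨n, hn⟩ := p e he
    exact ⟨n, by linarith⟩
  choose t ht using step
  let x : ℕ → Ω →ₘ[P] B := fun n => (t n.unpair.1 n.unpair.2).1 (s n.unpair.1 x0)
  have hx : ∀ n, x n ∈ K := fun n => hS.maps _ (t _ _).2 (hS.maps _ (hs _) hx0)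
  obtain ⟨w, hw, hw'⟩ := glue_cover hcl hcv hx (A := fun n =>
    {ω | c n.unpair.1 ω ≤ ρ ω + ε ω} ∩ {ω | ρ ω - ε ω ≤ ‖a ω - x n ω‖}) (fun n =>
      (nullMeasurableSet_le (hcm _) (hρm.add hε)).inter
        (nullMeasurableSet_le (hρm.sub hε)
          (a.stronglyMeasurable.sub (x n).stronglyMeasurable).norm.measurable.aemeasurable))
  refine ⟨w, hw, ?_⟩
  have hall : ∀ᵐ ω ∂P, ∀ n, ∀ y ∈ F, ‖y ω - x n ω‖ ≤ c n.unpair.1 ω :=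
    ae_all_iff.2 fun n => (ae_ball_iff hF.countable).2 fun y hy => hcs _ _ (t _ _).2 y hy
  filter_upwards [hcρ, ae_all_iff.2 ht, hw', hall] with ω h1 h2 h3 h4 he
  obtain ⟨k, hk⟩ := h1 _ he
  obtain ⟨j, hj⟩ := h2 k _ he
  obtain ⟨n, ⟨hn1, hn2⟩, hn3⟩ := h3 ⟨Nat.pair k j, by
    simp only [x, Nat.unpair_pair]
    exact ⟨hk.le, by change ρ ω - ε ω ≤ _; linarith⟩⟩
  rw [hn3]
  exact ⟨fun y hy => (h4 n y hy).trans hn1, hn2⟩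

end

section
variable {S : Set ((Ω →ₘ[P] B) → (Ω →ₘ[P] B))} {K : Set (Ω →ₘ[P] B)} {x0 : Ω →ₘ[P] B}

lemma dep_seq {α : Type*} [Nonempty α] (Good : List α → Prop) (R : List α → α → Prop) (h0 : Good [])
    (h : ∀ l, Good l → ∃ a, R l a ∧ Good (l ++ [a])) :
    ∃ z : ℕ → α, ∀ n, Good ((List.range n).map z) ∧ R ((List.range n).map z) (z n) := by
  choose! a ha hg using h
  let L : ℕ → List α := fun n => Nat.rec [] (fun _ l => l ++ [a l]) n
  have hL : ∀ n, L (n + 1) = L n ++ [a (L n)] := fun n => rfl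
  have hgood : ∀ n, Good (L n) := by
    intro n
    induction n with
    | zero => exact h0
    | succ n ih => rw [hL]; exact hg _ ih
  have heq : ∀ n, (List.range n).map (fun n => a (L n)) = L n := by
    intro n
    induction n with
    | zero => rfl
    | succ n ih => rw [List.range_succ, List.map_append, ih, hL]; rfl
  refine ⟨fun n => a (L n), fun n => ?_⟩
  rw [heq]
  exact ⟨hgood n, ha _ (hgood n)⟩

lemma list_avg {E : Type*} [AddCommGroup E] [Module ℝ E] {K : Set E} (hK : Convex ℝ K)
    {l : List E} (hl : l ≠ []) (h : ∀ x ∈ l, x ∈ K) : (l.length : ℝ)⁻¹ • l.sum ∈ K := by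
  have h1 : l.sum = ∑ i : Fin l.length, l.get i := by
    conv_lhs => rw [← List.ofFn_get l]
    rw [List.sum_ofFn]
  have hn : (l.length : ℝ) ≠ 0 := by
    simpa using hl
  rw [h1, Finset.smul_sum]
  apply hK.sum_mem
  · intro i _; positivity
  · simp [hn]
  · intro i _; exact h _ (List.get_mem _ _)

lemma two_rho (hS : Sgp S K) (hx0 : x0 ∈ K) {ρ : Ω → ℝ} (hρ : ∀ y ∈ K, AsB S x0 {y} ρ)
    {x y : Ω →ₘ[P] B} (hx : x ∈ K) (hy : y ∈ K) : ∀ᵐ ω ∂P, ‖x ω - y ω‖ ≤ 2 * ρ ω := by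
  obtain ⟨c, hc, h⟩ := AsB.finite hS hx0 hρ (F := {x, y}) (by simp)
    (by rintro z (rfl | rfl) <;> assumption)
  have : ∀ᵐ ω ∂P, ∀ k, ‖x ω - y ω‖ ≤ 2 * c k ω := by
    refine ae_all_iff.2 fun k => ?_
    obtain ⟨-, s, hs, h⟩ := hc k
    filter_upwards [h id hS.id_mem x (by simp), h id hS.id_mem y (by simp)] with ω a b
    have := norm_sub_le_norm_sub_add_norm_sub (x ω) (id (s x0) ω) (y ω)
    rw [norm_sub_rev (id (s x0) ω)] at this
    linarith
  filter_upwards [h, this] with ω a b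
  refine le_of_forall_pos_le_add fun ε hε => ?_
  obtain ⟨k, hk⟩ := a (ε / 2) (by linarith)
  linarith [b k]

lemma diametral_seq [IsFiniteMeasure P] (hS : Sgp S K) (hcl : SeqClosed K) (hcv : LConvex K)
    (hx0 : x0 ∈ K) {ρ : Ω → ℝ} (hρm : AEMeasurable ρ P) (hρ0 : ∀ᵐ ω ∂P, 0 ≤ ρ ω)
    (hρ : ∀ y ∈ K, AsB S x0 {y} ρ)
    (hρ' : ∀ y ∈ K, ∀ c, Ub S x0 {y} c → ∀ᵐ ω ∂P, ρ ω ≤ c ω) {ξ : Ω → ℝ}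
    (hξ : ∀ x ∈ K, ∀ᵐ ω ∂P, ‖x ω‖ ≤ ξ ω) :
    ∃ z : ℕ → Ω →ₘ[P] B, (∀ n, z n ∈ K) ∧ (∀ i j, ∀ᵐ ω ∂P, ‖z i ω - z j ω‖ ≤ ρ ω) ∧
      ∀ n : ℕ, ∀ᵐ ω ∂P, n * ρ ω - n * (((n : ℝ) + 1) ^ 2)⁻¹ * (2 + ρ ω) ≤
        ‖(∑ i ∈ Finset.range n, z i ω) - (n : ℝ) • z n ω‖ := by
  let Good : List (Ω →ₘ[P] B) → Prop := fun l => (∀ x ∈ l, x ∈ K) ∧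
    ∃ δ : Ω → ℝ, AEMeasurable δ P ∧ (∀ᵐ ω ∂P, 0 < ρ ω → 0 < δ ω ∧ δ ω ≤ ρ ω) ∧
      ∀ x ∈ l, ∀ y ∈ l, ∀ᵐ ω ∂P, 0 < ρ ω → ‖x ω - y ω‖ ≤ ρ ω - δ ω
  let R : List (Ω →ₘ[P] B) → (Ω →ₘ[P] B) → Prop := fun l a => ∀ᵐ ω ∂P,
    l.length * ρ ω - l.length * (((l.length : ℝ) + 1) ^ 2)⁻¹ * (2 + ρ ω) ≤
        ‖l.sum ω - (l.length : ℝ) • a ω‖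
  obtain ⟨z, hz⟩ := dep_seq Good R
    ⟨by simp, ρ, hρm, Eventually.of_forall fun ω h => ⟨h, le_rfl⟩, by simp⟩ (by
    rintro l ⟨hlK, δ, hδm, hδ, hd⟩
    rcases l with _ | ⟨p, l'⟩
    · refine ⟨x0, by simp [R], by simpa using hx0, δ, hδm, hδ, ?_⟩
      intro x hx y hy
      simp only [List.nil_append, List.mem_singleton] at hx hy
      subst hx; subst hy
      filter_upwards [hδ] with ω h1 h2
      simpa using (h1 h2).2
    set l := p :: l' with hl
    have hpl : p ∈ l := by simp [hl]
    have hpK : p ∈ K := hlK p hpl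
    have hne : l ≠ [] := by simp [hl]
    have hn : (0 : ℝ) < l.length := by simp [hl]; positivity
    set n : ℝ := (l.length : ℝ) with hndef
    set θ : ℝ := ((n + 1) ^ 2)⁻¹ with hθ
    have hθ0 : 0 < θ := by positivity
    have hθ1 : θ ≤ 1 := by
      apply inv_le_one_of_one_le₀
      nlinarith
    have havg : n⁻¹ • l.sum ∈ K := list_avg hcv.convex hne hlK
    set a := n⁻¹ • l.sum with ha
    have hac : ∀ᵐ ω ∂P, l.sum ω = n • a ω := by
      filter_upwards [AEEqFun.coeFn_smul n⁻¹ l.sum] with ω h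
      rw [ha, h, Pi.smul_apply, smul_smul, mul_inv_cancel₀ hn.ne', one_smul]
    obtain ⟨w, hwK, hw⟩ := pick hS hcl hcv hx0 hρm hρ hρ' hξ (F := {x | x ∈ l})
      l.finite_toSet (fun x hx => hlK x hx) havg
      (ε := fun ω => min (θ * δ ω / 2) θ)
      (((hδm.const_mul θ).div_const 2).min aemeasurable_const)
    have hzc := real_comb_coe θ (1 - θ) p w
    have hzK : θ • p + (1 - θ) • w ∈ K :=
      hcv.convex hpK hwK hθ0.le (by linarith) (by ring)
    set zz := θ • p + (1 - θ) • w with hzz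
    have hnew : ∀ x ∈ l, ∀ᵐ ω ∂P, 0 < ρ ω → ‖x ω - zz ω‖ ≤ ρ ω - θ * δ ω / 2 := by
      intro x hx
      filter_upwards [hw, hzc, hδ, hd x hx p hpl] with ω h1 h2 h3 h4 h5
      obtain ⟨h6, h7⟩ := h3 h5
      obtain ⟨h8, -⟩ := h1 (lt_min (by positivity) hθ0)
      have h9 := h8 x hx
      have h10 := min_le_left (θ * δ ω / 2) θ
      have h11 : 0 < θ * δ ω := by positivity
      rw [h2]
      have : x ω - (θ • p ω + (1 - θ) • w ω) = θ • (x ω - p ω) + (1 - θ) • (x ω - w ω) := by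
        module
      rw [this]
      refine (norm_add_le _ _).trans ?_
      rw [norm_smul, norm_smul, Real.norm_eq_abs, Real.norm_eq_abs, abs_of_pos hθ0,
        abs_of_nonneg (by linarith)]
      have e1 := mul_le_mul_of_nonneg_left (h4 h5) hθ0.le
      have e2 := mul_le_mul_of_nonneg_left (h9.trans (add_le_add_right h10 _))
        (by linarith : 0 ≤ 1 - θ)
      nlinarith
    refine ⟨zz, ?_, ?_, fun ω => θ * δ ω / 2, (hδm.const_mul θ).div_const 2, ?_, ?_⟩
    · filter_upwards [hw, hzc, hδ, hac, hρ0] with ω h1 h2 h3 h4 h5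
      rcases h5.lt_or_eq with h5 | h5
      · obtain ⟨h6, h7⟩ := h3 h5
        obtain ⟨h8, h9⟩ := h1 (lt_min (by positivity) hθ0)
        have h10 := h8 p hpl
        have h11 := min_le_right (θ * δ ω / 2) θ
        set ε := min (θ * δ ω / 2) θ
        have h12 : ‖a ω - w ω‖ ≤ ‖a ω - zz ω‖ + θ * ‖p ω - w ω‖ := by
          have : a ω - w ω = (a ω - zz ω) + θ • (p ω - w ω) := by
            rw [h2]; module
          rw [this]
          refine (norm_add_le _ _).trans ?_
          rw [norm_smul, Real.norm_eq_abs, abs_of_pos hθ0]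
        have h13 : ‖l.sum ω - n • zz ω‖ = n * ‖a ω - zz ω‖ := by
          rw [h4, ← smul_sub, norm_smul, Real.norm_eq_abs, abs_of_pos hn]
        change n * ρ ω - n * θ * (2 + ρ ω) ≤ ‖l.sum ω - n • zz ω‖
        rw [h13]
        have e1 := mul_le_mul_of_nonneg_left h10 hθ0.le
        have h14 : ρ ω - θ * (2 + ρ ω) ≤ ‖a ω - zz ω‖ := by nlinarith
        have := mul_le_mul_of_nonneg_left h14 hn.le
        nlinarith
      · change n * ρ ω - n * θ * (2 + ρ ω) ≤ _
        refine le_trans ?_ (norm_nonneg _)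
        rw [← h5]
        have : 0 < n * θ := by positivity
        linarith
    · intro x hx
      rcases List.mem_append.1 hx with hx | hx
      · exact hlK x hx
      · rw [List.mem_singleton.1 hx]; exact hzK
    · filter_upwards [hδ] with ω h1 h2
      obtain ⟨h3, h4⟩ := h1 h2
      exact ⟨by positivity, by nlinarith⟩
    · intro x hx y hy
      rcases List.mem_append.1 hx with hx | hx <;> rcases List.mem_append.1 hy with hy | hy
      · filter_upwards [hδ, hd x hx y hy] with ω h1 h2 h3
        have := h2 h3
        nlinarith [h1 h3]
      · rw [List.mem_singleton.1 hy]; exact hnew x hx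
      · rw [List.mem_singleton.1 hx]
        filter_upwards [hnew y hy] with ω h1 h2
        rw [norm_sub_rev]; exact h1 h2
      · rw [List.mem_singleton.1 hx, List.mem_singleton.1 hy]
        filter_upwards [hδ] with ω h1 h2
        obtain ⟨h3, h4⟩ := h1 h2
        simp only [sub_self, norm_zero]
        nlinarith)
  have hzK : ∀ n, z n ∈ K := fun n => (hz (n + 1)).1.1 _ (by
    simp only [List.mem_map, List.mem_range]; exact ⟨n, by omega, rfl⟩)
  refine ⟨z, hzK, fun i j => ?_, fun n => ?_⟩
  · obtain ⟨-, δ, -, hδ, hd⟩ := (hz (max i j + 1)).1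
    have hm : ∀ k ≤ max i j, z k ∈ (List.range (max i j + 1)).map z := fun k hk => by
      simp only [List.mem_map, List.mem_range]; exact ⟨k, by omega, rfl⟩
    filter_upwards [hδ, hd _ (hm i (le_max_left _ _)) _ (hm j (le_max_right _ _)), hρ0,
      two_rho hS hx0 hρ (hzK i) (hzK j)] with ω h1 h2 h3 h4
    rcases h3.lt_or_eq with h5 | h5
    · linarith [h2 h5, h1 h5]
    · rw [← h5] at h4 ⊢; linarith
  · have h1 := (hz n).2
    have hsum : ((List.range n).map z).sum = ∑ i ∈ Finset.range n, z i := by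
      clear h1
      induction n with
      | zero => simp
      | succ n ih => rw [List.range_succ, Finset.sum_range_succ, ← ih]; simp
    simp only [R, List.length_map, List.length_range, hsum] at h1
    filter_upwards [h1, AEEqFun.coeFn_fun_finsetSum (μ := P) (Finset.range n) z] with ω h1 h2
    rw [h2] at h1
    exact h1

end

section
/-- The set of points asymptotically within distance `g n` of `w n`. -/
def asy (w : ℕ → B) (g : ℕ → ℝ) : Set B :=
  {b | ∀ ε > 0, ∃ N : ℕ, ∀ n ≥ N, ‖w n - b‖ ≤ g n + ε}

lemma asy_closed (w : ℕ → B) (g : ℕ → ℝ) : IsClosed (asy w g) := by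
  rw [← isSeqClosed_iff_isClosed]
  intro x b hx hb ε hε
  obtain ⟨k, hk⟩ := (Metric.tendsto_atTop.1 hb (ε / 2) (by linarith))
  obtain ⟨N, hN⟩ := hx k (ε / 2) (by linarith)
  refine ⟨N, fun n hn => ?_⟩
  have h1 := hN n hn
  have h2 := hk k le_rfl
  rw [dist_eq_norm] at h2
  have h3 := norm_sub_le_norm_sub_add_norm_sub (w n) (x k) b
  linarith

lemma asy_convex (w : ℕ → B) (g : ℕ → ℝ) : Convex ℝ (asy w g) := by
  intro x hx y hy a b ha hb hab ε hε
  obtain ⟨N, hN⟩ := hx ε hε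
  obtain ⟨M, hM⟩ := hy ε hε
  refine ⟨max N M, fun n hn => ?_⟩
  have h1 := hN n (le_of_max_le_left hn)
  have h2 := hM n (le_of_max_le_right hn)
  have : w n - (a • x + b • y) = a • (w n - x) + b • (w n - y) := by
    obtain rfl : b = 1 - a := by linarith
    module
  rw [this]
  refine (norm_add_le _ _).trans ?_
  rw [norm_smul, norm_smul, Real.norm_eq_abs, Real.norm_eq_abs, abs_of_nonneg ha,
    abs_of_nonneg hb]
  have e1 := mul_le_mul_of_nonneg_left h1 ha
  have e2 := mul_le_mul_of_nonneg_left h2 hb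
  have e3 : a * (g n + ε) + b * (g n + ε) = g n + ε := by rw [← add_mul, hab, one_mul]
  linarith

lemma asy_mem (z : ℕ → B) {r : ℝ} (h : ∀ i j, ‖z i - z j‖ ≤ r) (j : ℕ) :
    z j ∈ asy (fun n => (∑ i ∈ Finset.range n, z i) - ((n : ℝ) - 1) • z n)
      (fun n => ((n : ℝ) - 1) * r) := by
  intro ε hε
  refine ⟨j + 1, fun n hn => ?_⟩
  have hj : j ∈ Finset.range n := by simp; omega
  have hcard : (((Finset.range n).erase j).card : ℝ) = (n : ℝ) - 1 := by
    rw [Finset.card_erase_of_mem hj, Finset.card_range, Nat.cast_sub (by omega)]; simp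
  have h1 : (∑ i ∈ Finset.range n, z i) - ((n : ℝ) - 1) • z n - z j
      = ∑ i ∈ (Finset.range n).erase j, (z i - z n) := by
    rw [Finset.sum_sub_distrib, Finset.sum_const, ← Finset.add_sum_erase _ _ hj, ← hcard,
      Nat.cast_smul_eq_nsmul]
    abel
  change ‖(∑ i ∈ Finset.range n, z i) - ((n : ℝ) - 1) • z n - z j‖ ≤ ((n : ℝ) - 1) * r + ε
  rw [h1]
  have := norm_sum_le_of_le ((Finset.range n).erase j) (fun i _ => h i n)
  rw [Finset.sum_const, nsmul_eq_mul, hcard] at this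
  linarith

lemma asy_lower (z : ℕ → B) {r : ℝ} {b : B} {R : ℝ}
    (hb : b ∈ asy (fun n => (∑ i ∈ Finset.range n, z i) - ((n : ℝ) - 1) • z n)
      (fun n => ((n : ℝ) - 1) * r))
    (hlow : ∀ n : ℕ, n * r - n * (((n : ℝ) + 1) ^ 2)⁻¹ * (2 + r) ≤
        ‖(∑ i ∈ Finset.range n, z i) - (n : ℝ) • z n‖)
    (hr : 0 ≤ r) (hR : ∀ n, ‖b - z n‖ ≤ R) : r ≤ R := by
  refine le_of_forall_pos_le_add fun ε hε => ?_
  obtain ⟨N, hN⟩ := hb (ε / 2) (by linarith)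
  obtain ⟨M, hM⟩ := exists_nat_gt ((2 + r) / (ε / 2))
  set n := max N M
  have h1 := hN n (le_max_left _ _)
  have h2 := hlow n
  have h3 := hR n
  have hMn : (M : ℝ) ≤ n := by exact_mod_cast le_max_right N M
  have h4 : (∑ i ∈ Finset.range n, z i) - (n : ℝ) • z n =
      ((∑ i ∈ Finset.range n, z i) - ((n : ℝ) - 1) • z n - b) + (b - z n) := by module
  rw [h4] at h2
  have h5 := norm_add_le ((∑ i ∈ Finset.range n, z i) - ((n : ℝ) - 1) • z n - b) (b - z n)
  have h6 : (n : ℝ) * (((n : ℝ) + 1) ^ 2)⁻¹ * (2 + r) ≤ ε / 2 := by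
    have hn : (0 : ℝ) ≤ n := Nat.cast_nonneg n
    have e1 : (2 + r) < n * (ε / 2) := by
      rw [div_lt_iff₀ (by linarith)] at hM
      nlinarith
    have e2 : (n : ℝ) * (((n : ℝ) + 1) ^ 2)⁻¹ * (2 + r) = (2 + r) * n / ((n : ℝ) + 1) ^ 2 := by
      rw [div_eq_mul_inv]; ring
    rw [e2, div_le_iff₀ (by positivity)]
    nlinarith [mul_nonneg hn hε.le, mul_le_mul_of_nonneg_left e1.le hn]
  change ‖(∑ i ∈ Finset.range n, z i) - ((n : ℝ) - 1) • z n - b‖ ≤ ((n : ℝ) - 1) * r + ε / 2 at h1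
  linarith

lemma sgp_closure {𝒯 : Set ((Ω →ₘ[P] B) → (Ω →ₘ[P] B))} {K : Set (Ω →ₘ[P] B)}
    (hmaps : ∀ T ∈ 𝒯, MapsTo T K K)
    (hcomm : ∀ T ∈ 𝒯, ∀ S ∈ 𝒯, ∀ x ∈ K, T (S x) = S (T x)) :
    ∃ S, 𝒯 ⊆ S ∧ Sgp S K := by
  let M : Submonoid (Function.End (Ω →ₘ[P] B)) := Submonoid.closure 𝒯
  have hm : ∀ s : Function.End (Ω →ₘ[P] B), s ∈ M → ∀ x ∈ K, s x ∈ K := by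
    intro s hs
    induction hs using Submonoid.closure_induction with
    | mem s hs => exact hmaps s hs
    | one => exact fun x hx => hx
    | mul s t _ _ ihs iht => exact fun x hx => ihs _ (iht x hx)
  have hc1 : ∀ T ∈ 𝒯, ∀ s : Function.End (Ω →ₘ[P] B), s ∈ M → ∀ x ∈ K, T (s x) = s (T x) := by
    intro T hT s hs
    induction hs using Submonoid.closure_induction with
    | mem s hs => exact hcomm T hT s hs
    | one => exact fun x hx => rfl
    | mul s t _ ht ihs iht =>
      intro x hx
      change T (s (t x)) = s (t (T x))
      rw [ihs _ (hm t ht x hx), iht x hx]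
  have hc2 : ∀ s : Function.End (Ω →ₘ[P] B), s ∈ M → ∀ t : Function.End (Ω →ₘ[P] B), t ∈ M →
      ∀ x ∈ K, s (t x) = t (s x) := by
    intro s hs t ht
    induction hs using Submonoid.closure_induction with
    | mem s hs => exact hc1 s hs t ht
    | one => exact fun x hx => rfl
    | mul s u _ hu ihs ihu =>
      intro x hx
      change s (u (t x)) = t (s (u x))
      rw [ihu x hx, ihs _ (hm u hu x hx)]
  exact ⟨{s | s ∈ M}, fun s hs => Submonoid.subset_closure (M := Function.End (Ω →ₘ[P] B)) hs, ⟨M.one_mem, fun s hs t ht => M.mul_mem hs ht,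
    fun s hs x hx => hm s hs x hx, hc2⟩⟩

lemma mk_coe_le {f : Ω → ℝ} (hf : AEStronglyMeasurable f P) (x : Ω →ₘ[P] ℝ)
    (h : ∀ᵐ ω ∂P, x ω ≤ f ω) : x ≤ AEEqFun.mk f hf := by
  rw [← AEEqFun.coeFn_le]
  filter_upwards [h, AEEqFun.coeFn_mk f hf] with ω h1 h2
  rw [h2]; exact h1

/-- A bounded diametral sequence forces the radius to vanish under random normal structure. -/
lemma rho_zero [IsFiniteMeasure P] {G K : Set (Ω →ₘ[P] B)} (hns : RandNormalStructure G)
    (hKG : K ⊆ G) (hcl : SeqClosed K) (hcv : LConvex K) {ξ ρ : Ω → ℝ} (hξm : AEMeasurable ξ P)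
    (hξ : ∀ x ∈ K, ∀ᵐ ω ∂P, ‖x ω‖ ≤ ξ ω) (hρm : AEMeasurable ρ P) (hρ0 : ∀ᵐ ω ∂P, 0 ≤ ρ ω)
    {z : ℕ → Ω →ₘ[P] B} (hzK : ∀ n, z n ∈ K) (hd : ∀ i j, ∀ᵐ ω ∂P, ‖z i ω - z j ω‖ ≤ ρ ω)
    (hlow : ∀ n : ℕ, ∀ᵐ ω ∂P, n * ρ ω - n * (((n : ℝ) + 1) ^ 2)⁻¹ * (2 + ρ ω) ≤
        ‖(∑ i ∈ Finset.range n, z i ω) - (n : ℝ) • z n ω‖) : ∀ᵐ ω ∂P, ρ ω ≤ 0 := by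
  let 𝒞 : Set (Set (Ω →ₘ[P] B)) := {C | SeqClosed C ∧ LConvex C ∧ ∀ n, z n ∈ C}
  let H := ⋂₀ 𝒞
  have hHsub : ∀ C, SeqClosed C → LConvex C → (∀ n, z n ∈ C) → H ⊆ C := fun C h1 h2 h3 =>
    sInter_subset_of_mem ⟨h1, h2, h3⟩
  have hHK : H ⊆ K := hHsub K hcl hcv hzK
  have hHcl : SeqClosed H := SeqClosed.sInter fun C hC => hC.1
  have hHcv : LConvex H := LConvex.sInter fun C hC => hC.2.1
  have hzH : ∀ n, z n ∈ H := fun n => mem_sInter.2 fun C hC => hC.2.2 n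
  -- upper bound on the diameter
  have hball : ∀ (c : Ω → B), (∀ n, ∀ᵐ ω ∂P, ‖z n ω - c ω‖ ≤ ρ ω) →
      ∀ y ∈ H, ∀ᵐ ω ∂P, ‖y ω - c ω‖ ≤ ρ ω := by
    intro c hc y hy
    have := hHsub (sel P fun ω => Metric.closedBall (c ω) (ρ ω))
      (sel_closed fun ω => Metric.isClosed_closedBall) (sel_convex fun ω => convex_closedBall _ _)
      (fun n => by
        change ∀ᵐ ω ∂P, z n ω ∈ Metric.closedBall (c ω) (ρ ω)
        filter_upwards [hc n] with ω h
        simpa [dist_eq_norm] using h) hy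
    filter_upwards [this] with ω h
    simpa [dist_eq_norm] using h
  have hdiam : ∀ x ∈ H, ∀ y ∈ H, ∀ᵐ ω ∂P, ‖x ω - y ω‖ ≤ ρ ω := by
    intro x hx y hy
    refine hball y (fun n => ?_) x hx
    filter_upwards [hball (z n) (fun m => hd m n) y hy] with ω h
    rwa [norm_sub_rev]
  -- lower bound on the radius
  have hrad : ∀ y ∈ H, ∀ R : Ω → ℝ, (∀ n, ∀ᵐ ω ∂P, ‖y ω - z n ω‖ ≤ R ω) →
      ∀ᵐ ω ∂P, ρ ω ≤ R ω := by
    intro y hy R hR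
    have h1 : ∀ᵐ ω ∂P, ∀ i j, ‖z i ω - z j ω‖ ≤ ρ ω :=
      ae_all_iff.2 fun i => ae_all_iff.2 fun j => hd i j
    have := hHsub (sel P fun ω => asy
        (fun n => (∑ i ∈ Finset.range n, z i ω) - ((n : ℝ) - 1) • z n ω)
        (fun n => ((n : ℝ) - 1) * ρ ω))
      (sel_closed fun ω => asy_closed _ _) (sel_convex fun ω => asy_convex _ _)
      (fun n => by
        filter_upwards [h1] with ω h
        exact asy_mem (fun i => z i ω) h n) hy
    filter_upwards [this, ae_all_iff.2 hlow, hρ0, ae_all_iff.2 hR] with ω e1 e2 e3 e4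
    exact asy_lower (fun i => z i ω) e1 e2 e3 e4
  have hbd : ∀ x ∈ H, ∀ y ∈ H, nrm (x - y) ≤ AEEqFun.mk ρ hρm.aestronglyMeasurable := by
    intro x hx y hy
    apply mk_coe_le
    filter_upwards [hdiam x hx y hy, nrm_sub_coe x y] with ω h1 h2
    rw [h2]; exact h1
  have hLD : IsLUB {ξ | ∃ x ∈ H, ∃ y ∈ H, ξ = nrm (x - y)} (Dd H) :=
    lsup_isLUB ⟨_, z 0, hzH 0, z 0, hzH 0, rfl⟩ (by
      rintro s ⟨x, hx, y, hy, rfl⟩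
      exact hbd x hx y hy)
  have hLR : ∀ x ∈ H, IsLUB ((fun y => nrm (x - y)) '' H) (Rr H x) := fun x hx =>
    lsup_isLUB ⟨_, z 0, hzH 0, rfl⟩ (by rintro s ⟨y, hy, rfl⟩; exact hbd x hx y hy)
  have hDρ : ∀ᵐ ω ∂P, Dd H ω ≤ ρ ω := by
    have : Dd H ≤ AEEqFun.mk ρ hρm.aestronglyMeasurable :=
      hLD.2 (by rintro s ⟨x, hx, y, hy, rfl⟩; exact hbd x hx y hy)
    filter_upwards [AEEqFun.coeFn_le.2 this, AEEqFun.coeFn_mk ρ hρm.aestronglyMeasurable]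
      with ω h1 h2
    rwa [h2] at h1
  have hD : ∀ x ∈ H, ∀ y ∈ H, ∀ᵐ ω ∂P, ‖x ω - y ω‖ ≤ Dd H ω := by
    intro x hx y hy
    filter_upwards [AEEqFun.coeFn_le.2 (hLD.1 ⟨x, hx, y, hy, rfl⟩), nrm_sub_coe x y] with ω h1 h2
    rwa [h2] at h1
  have hD0 : Dd H = 0 := by
    by_contra hne
    obtain ⟨w, hw, hlt⟩ := hns H (hHK.trans hKG) ⟨_, hzH 0⟩
      ⟨AEEqFun.mk ξ hξm.aestronglyMeasurable, fun h hh => mk_coe_le _ _ (by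
        filter_upwards [hξ h (hHK hh), nrm_coe h] with ω h1 h2
        rw [h2]; exact h1)⟩ hHcl hHcv hne
    have hρR : ∀ᵐ ω ∂P, ρ ω ≤ Rr H w ω := hrad w hw _ fun n => by
      filter_upwards [AEEqFun.coeFn_le.2 ((hLR w hw).1 ⟨z n, hzH n, rfl⟩), nrm_sub_coe w (z n)]
        with ω h1 h2
      rwa [h2] at h1
    apply hne
    apply AEEqFun.ext
    filter_upwards [hlt, hρR, hDρ, hD _ (hzH 0) _ (hzH 0), AEEqFun.coeFn_zero (μ := P) (β := ℝ)]
      with ω h1 h2 h3 h4 h5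
    rw [h5]
    rw [sub_self, norm_zero] at h4
    rcases h4.lt_or_eq with h | h
    · linarith [h1 h]
    · exact h.symm
  refine hrad (z 0) (hzH 0) (fun _ => 0) fun n => ?_
  filter_upwards [hD _ (hzH 0) _ (hzH n), AEEqFun.coeFn_zero (μ := P) (β := ℝ)] with ω h1 h2
  rw [hD0, h2] at h1
  exact h1

end

/-- A commutative family of nonexpansive self-mappings of an `L⁰`-convexly compact set with
random normal structure has a common fixed point. -/
theorem common_fixed_point_of_commutative_nonexpansive
    {Ω : Type*} [MeasurableSpace Ω] {P : Measure Ω} [IsProbabilityMeasure P]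
    {B : Type*} [NormedAddCommGroup B] [NormedSpace ℝ B] [CompleteSpace B]
    (G : Set (Ω →ₘ[P] B)) (hG : ConvexlyCompact G) (hns : RandNormalStructure G)
    (𝒯 : Set ((Ω →ₘ[P] B) → (Ω →ₘ[P] B)))
    (hmaps : ∀ T ∈ 𝒯, Set.MapsTo T G G)
    (hnonexp : ∀ T ∈ 𝒯, NonexpansiveOn G T)
    (hcomm : ∀ T ∈ 𝒯, ∀ S ∈ 𝒯, ∀ x ∈ G, T (S x) = S (T x)) :
    ∃ x ∈ G, ∀ T ∈ 𝒯, T x = x := by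
  obtain ⟨ξ, hξm, hξ⟩ := bounded_of_compact hG
  obtain ⟨K, hKG, hadm, hmin⟩ := exists_minimal_adm hG 𝒯 hmaps
  obtain ⟨⟨x0, hx0⟩, hcl, hcv, hKmaps⟩ := id hadm
  obtain ⟨S, hTS, hS⟩ := sgp_closure hKmaps
    (fun T hT S hS x hx => hcomm T hT S hS x (hKG hx))
  have hξK : ∀ x ∈ K, ∀ᵐ ω ∂P, ‖x ω‖ ≤ ξ ω := fun x hx => hξ x (hKG hx)
  obtain ⟨ρ, hρm, hρ0, hρ, hρ'⟩ := exists_const_radius hS hTS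
    (fun T hT x hx y hy => hnonexp T hT x (hKG hx) y (hKG hy)) hadm hmin hx0 hξm hξK
  obtain ⟨z, hzK, hd, hlow⟩ := diametral_seq hS hcl hcv hx0 hρm hρ0 hρ hρ' hξK
  have hz := rho_zero hns hKG hcl hcv hξm hξK hρm hρ0 hzK hd hlow
  refine ⟨x0, hKG hx0, fun T hT => AEEqFun.ext ?_⟩
  filter_upwards [hz, two_rho hS hx0 hρ (hKmaps T hT hx0) hx0] with ω h1 h2
  have h3 : ‖T x0 ω - x0 ω‖ ≤ 0 := by linarith
  exact sub_eq_zero.1 (norm_le_zero_iff.1 h3)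

end RNM
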